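/- Let U be a topological space, φ a continuous semiflow on U, and x₀ a fixed point of φ. For V ⊆ U define the local stable set W^s(x₀, V) := { z ∈ V : φ_s z ∈ V for all s ≥ 0 and φ_s z → x₀ as s → ∞ }. Assume that every neighborhood O of x₀ in U contains a semiflow invariant set W with x₀ ∈ W ⊆ O ∩ W^s(x₀, U) which is relatively open in W^s(x₀, U). Then for every open subset N ⊆ U with x₀ ∈ N, the local stable set W^s(x₀, N) is a relatively open neighborhood of x₀ in W^s(x₀, U). -/

import Mathlib

open Filter Topology

/-- A continuous semiflow on a topological space `U`. -/
def IsSemiflow {U : Type*} [TopologicalSpace U] (φ : ℝ → U → U) : Prop :=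
  ContinuousOn (fun p : ℝ × U => φ p.1 p.2) (Set.Ici (0 : ℝ) ×ˢ Set.univ) ∧
  (∀ γ, φ 0 γ = γ) ∧
  ∀ s t : ℝ, 0 ≤ s → 0 ≤ t → ∀ γ, φ s (φ t γ) = φ (s + t) γ

/-- The local stable set `W^s(x₀, V)` of a fixed point `x₀` relative to
`V`: points of `V` whose forward trajectory stays in `V` and converges to
`x₀`. -/
def localStableSet {U : Type*} [TopologicalSpace U] (φ : ℝ → U → U)
    (x₀ : U) (V : Set U) : Set U :=
  {z : U | z ∈ V ∧ (∀ s : ℝ, 0 ≤ s → φ s z ∈ V) ∧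
    Tendsto (fun s : ℝ => φ s z) atTop (𝓝 x₀)}

/-- A continuous semiflow, extended by the identity to negative times, is jointly continuous. -/
theorem IsSemiflow.continuous_max {U : Type*} [TopologicalSpace U] {φ : ℝ → U → U}
    (hφ : IsSemiflow φ) : Continuous fun p : U × ℝ => φ (max p.2 0) p.1 :=
  hφ.1.comp_continuous (f := fun p : U × ℝ => (max p.2 0, p.1)) (by fun_prop)
    fun p => ⟨le_max_right p.2 0, Set.mem_univ _⟩

theorem IsSemiflow.continuous_apply {U : Type*} [TopologicalSpace U] {φ : ℝ → U → U}
    (hφ : IsSemiflow φ) {t : ℝ} (ht : 0 ≤ t) : Continuous (φ t) := by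
  simpa [Function.comp_def, max_eq_left ht] using
    hφ.continuous_max.comp (Continuous.prodMk_left t)

/-- Staying in an open set during a compact time interval is an open condition on the initial
point. -/
theorem IsSemiflow.eventually_forall_mem_Icc {U : Type*} [TopologicalSpace U] {φ : ℝ → U → U}
    (hφ : IsSemiflow φ) {N : Set U} (hN : IsOpen N) {z : U} {T : ℝ}
    (hz : ∀ s ∈ Set.Icc 0 T, φ s z ∈ N) : ∀ᶠ y in 𝓝 z, ∀ s ∈ Set.Icc 0 T, φ s y ∈ N := by
  have h : ∀ᶠ y in 𝓝 z, ∀ s ∈ Set.Icc 0 T, φ (max s 0) y ∈ N := by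
    refine isCompact_Icc.eventually_forall_of_forall_eventually
      (P := fun y s => φ (max s 0) y ∈ N) fun s hs => ?_
    refine hφ.continuous_max.continuousAt.eventually_mem (hN.mem_nhds ?_)
    simpa [max_eq_left hs.1] using hz s hs
  filter_upwards [h] with y hy s hs
  simpa [max_eq_left hs.1] using hy s hs

theorem localStableSet_mono {U : Type*} [TopologicalSpace U] {φ : ℝ → U → U} {x₀ : U}
    {V V' : Set U} (h : V ⊆ V') : localStableSet φ x₀ V ⊆ localStableSet φ x₀ V' :=
  fun _ hz => ⟨h hz.1, fun s hs => h (hz.2.1 s hs), hz.2.2⟩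

theorem IsSemiflow.apply_mem_localStableSet {U : Type*} [TopologicalSpace U] {φ : ℝ → U → U}
    (hφ : IsSemiflow φ) {x₀ z : U} {V : Set U} (hz : z ∈ localStableSet φ x₀ V) {t : ℝ}
    (ht : 0 ≤ t) : φ t z ∈ localStableSet φ x₀ V := by
  refine ⟨hz.2.1 t ht, fun s hs => ?_, ?_⟩
  · rw [hφ.2.2 s t hs ht]
    exact hz.2.1 _ (add_nonneg hs ht)
  · refine (hz.2.2.comp (tendsto_atTop_add_const_right atTop t tendsto_id)).congr' ?_
    filter_upwards [eventually_ge_atTop 0] with s hs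
    exact (hφ.2.2 s t hs ht z).symm

/-- if every neighborhood `O` of the fixed point `x₀` contains a
semiflow invariant, relatively open (in `W^s(x₀,U)`) set `W` with
`x₀ ∈ W ⊆ O ∩ W^s(x₀,U)`, then for every open `N ∋ x₀` the local stable set
`W^s(x₀,N)` is a relatively open neighborhood of `x₀` in `W^s(x₀,U)`. -/
theorem localStableSet_relOpen_nhd
    {U : Type*} [TopologicalSpace U] (φ : ℝ → U → U) (hφ : IsSemiflow φ)
    (x₀ : U) (hx₀ : ∀ s : ℝ, 0 ≤ s → φ s x₀ = x₀)
    (hnbhd : ∀ O : Set U, O ∈ 𝓝 x₀ →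
      ∃ W : Set U, x₀ ∈ W ∧ W ⊆ O ∩ localStableSet φ x₀ Set.univ ∧
        (∀ s : ℝ, 0 ≤ s → ∀ z ∈ W, φ s z ∈ W) ∧
        ∃ V : Set U, IsOpen V ∧ W = V ∩ localStableSet φ x₀ Set.univ) :
    ∀ N : Set U, IsOpen N → x₀ ∈ N →
      x₀ ∈ localStableSet φ x₀ N ∧
      localStableSet φ x₀ N ⊆ localStableSet φ x₀ Set.univ ∧
      ∃ V : Set U, IsOpen V ∧
        localStableSet φ x₀ N = V ∩ localStableSet φ x₀ Set.univ := by
  intro N hN hxN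
  refine ⟨⟨hxN, fun s hs => (hx₀ s hs).symm ▸ hxN, ?_⟩,
    localStableSet_mono (Set.subset_univ N), ?_⟩
  · refine tendsto_const_nhds.congr' ?_
    filter_upwards [eventually_ge_atTop 0] with s hs
    exact (hx₀ s hs).symm
  obtain ⟨W, hxW, hWN, hWinv, V, hV, rfl⟩ := hnbhd N (hN.mem_nhds hxN)
  refine ⟨interior {y | y ∈ localStableSet φ x₀ Set.univ → y ∈ localStableSet φ x₀ N},
    isOpen_interior, Set.Subset.antisymm (fun z hz => ⟨?_, localStableSet_mono
      (Set.subset_univ N) hz⟩) fun z hz => interior_subset hz.1 hz.2⟩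
  obtain ⟨T, hTV, hT⟩ :=
    ((hz.2.2.eventually_mem (hV.mem_nhds hxW.1)).and (eventually_ge_atTop 0)).exists
  rw [mem_interior_iff_mem_nhds]
  filter_upwards [hφ.eventually_forall_mem_Icc hN fun s (hs : s ∈ Set.Icc 0 T) => hz.2.1 s hs.1,
    (hφ.continuous_apply hT).continuousAt.eventually_mem (hV.mem_nhds hTV)] with y hyN hyV hy
  have hyN' : ∀ s : ℝ, 0 ≤ s → φ s y ∈ N := by
    intro s hs
    rcases le_total s T with hsT | hTs
    · exact hyN s ⟨hs, hsT⟩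
    · have h := (hWN (hWinv (s - T) (sub_nonneg.2 hTs) _
        ⟨hyV, hφ.apply_mem_localStableSet hy hT⟩)).1
      rwa [hφ.2.2 _ _ (sub_nonneg.2 hTs) hT, sub_add_cancel] at h
  exact ⟨hφ.2.1 y ▸ hyN' 0 le_rfl, hyN', hy.2.2⟩
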